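/- arXiv:math/0309224 — 3 statements merged into one kernel-verified Lean document; each statement's English description precedes it below -/
import Mathlib

section
/- For every integer k ≥ 1, the set of positive integers m for which there exist at least k distinct values among the iterates T^(i)(m) (i ≥ 1) that are strictly less than m has natural density one. -/
open Filter

/-- The 3x+1 function `T : ℤ → ℤ`. -/
def collatzT (x : ℤ) : ℤ := if x % 2 = 1 then (3 * x + 1) / 2 else x / 2

open scoped Classical

/-- The number of odd terms among the first `n` terms of the `collatzT`-orbit of `x`. -/
def collatzOddCount (x : ℤ) : ℕ → ℕ
  | 0 => 0
  | n + 1 => collatzOddCount x n + if collatzT^[n] x % 2 = 1 then 1 else 0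

theorem le_two_mul_collatzT {x : ℤ} (hx : 0 ≤ x) : x ≤ 2 * collatzT x := by
  unfold collatzT
  split_ifs <;> omega

theorem collatzT_iterate_nonneg {x : ℤ} (hx : 0 ≤ x) (n : ℕ) : 0 ≤ collatzT^[n] x := by
  induction n with
  | zero => simpa
  | succ n ih =>
    rw [Function.iterate_succ_apply']
    linarith [le_two_mul_collatzT ih]

theorem exists_collatzT_iterate_mem_dyadic {x : ℤ} (hx : 0 < x) (j : ℕ)
    (h : ∃ n, collatzT^[n] x * 2 ^ j < x) :
    ∃ i, 1 ≤ i ∧ collatzT^[i] x * 2 ^ j < x ∧ x ≤ collatzT^[i] x * 2 ^ (j + 1) := by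
  have hlt := Nat.find_spec h
  have hmin := fun m => Nat.find_min h (m := m)
  generalize Nat.find h = i at hlt hmin
  cases i with
  | zero =>
    have : (1 : ℤ) ≤ 2 ^ j := one_le_pow₀ (by norm_num)
    simp only [Function.iterate_zero, id] at hlt
    nlinarith
  | succ i =>
    refine ⟨i + 1, by omega, hlt, ?_⟩
    have h1 := hmin i (by omega)
    have h2 := le_two_mul_collatzT (collatzT_iterate_nonneg hx.le i)
    have h3 : (0 : ℤ) < 2 ^ j := by positivity
    rw [Function.iterate_succ_apply', pow_succ]
    nlinarith

theorem exists_finset_collatzT_iterate_lt {x : ℤ} (hx : 0 < x) {k n : ℕ}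
    (h : collatzT^[n] x * 2 ^ k < x) :
    ∃ s : Finset ℤ, s.card = k ∧ ∀ y ∈ s, y < x ∧ ∃ i : ℕ, 1 ≤ i ∧ collatzT^[i] x = y := by
  have hex : ∀ j : Fin k, ∃ i, 1 ≤ i ∧ collatzT^[i] x * 2 ^ (j : ℕ) < x ∧
      x ≤ collatzT^[i] x * 2 ^ ((j : ℕ) + 1) := fun j =>
    exists_collatzT_iterate_mem_dyadic hx j ⟨n, lt_of_le_of_lt
      (mul_le_mul_of_nonneg_left (pow_le_pow_right₀ (by norm_num) j.2.le)
        (collatzT_iterate_nonneg hx.le n)) h⟩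
  choose f hf1 hf2 hf3 using hex
  have hanti : StrictAnti fun j => collatzT^[f j] x := by
    intro i j hij
    have h1 : collatzT^[f i] x * 2 ^ ((i : ℕ) + 1) ≤ collatzT^[f i] x * 2 ^ (j : ℕ) :=
      mul_le_mul_of_nonneg_left (pow_le_pow_right₀ (by norm_num) hij)
        (collatzT_iterate_nonneg hx.le _)
    exact lt_of_mul_lt_mul_right ((hf2 j).trans_le ((hf3 i).trans h1)) (by positivity)
  refine ⟨Finset.univ.image fun j => collatzT^[f j] x, ?_, ?_⟩
  · rw [Finset.card_image_of_injective _ hanti.injective, Finset.card_fin]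
  · intro y hy
    obtain ⟨j, -, rfl⟩ := Finset.mem_image.1 hy
    refine ⟨lt_of_le_of_lt ?_ (hf2 j), f j, hf1 j, rfl⟩
    exact le_mul_of_one_le_right (collatzT_iterate_nonneg hx.le _) (one_le_pow₀ (by norm_num))

theorem two_pow_mul_collatzT_iterate_le (x : ℤ) (n : ℕ) :
    2 ^ n * (collatzT^[n] x + 1) ≤ 3 ^ collatzOddCount x n * x + 3 ^ n := by
  induction n with
  | zero => simp [collatzOddCount]
  | succ n ih =>
    rw [Function.iterate_succ_apply', collatzOddCount]
    generalize collatzT^[n] x = y at *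
    have h23 : (2 : ℤ) ^ n ≤ 3 ^ n := pow_le_pow_left₀ (by norm_num) (by norm_num) n
    have h3 : (0 : ℤ) < 3 ^ n := by positivity
    by_cases hy : y % 2 = 1
    · have : 2 * (collatzT y + 1) = 3 * (y + 1) := by
        simp only [collatzT, hy, if_true]; omega
      simp only [hy, if_true, pow_succ]
      linear_combination 3 * ih + 2 ^ n * this
    · have : 2 * (collatzT y + 1) = y + 2 := by
        simp only [collatzT, hy, if_false]; omega
      simp only [hy, if_false, pow_succ, add_zero]
      nlinarith

theorem collatzT_add_two_mul (x t : ℤ) :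
    collatzT (x + 2 * t) = collatzT x + (if x % 2 = 1 then 3 else 1) * t := by
  unfold collatzT
  split_ifs <;> omega

theorem collatzT_iterate_add_two_pow_mul (x : ℤ) (n : ℕ) (t : ℤ) :
    collatzT^[n] (x + 2 ^ n * t) = collatzT^[n] x + 3 ^ collatzOddCount x n * t ∧
      collatzOddCount (x + 2 ^ n * t) n = collatzOddCount x n := by
  induction n generalizing t with
  | zero => simp [collatzOddCount]
  | succ n ih =>
    obtain ⟨h1, h2⟩ := ih (2 * t)
    rw [← mul_assoc, ← pow_succ] at h1 h2
    rw [mul_left_comm] at h1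
    have hmod : (collatzT^[n] x + 2 * (3 ^ collatzOddCount x n * t)) % 2
        = collatzT^[n] x % 2 := by omega
    refine ⟨?_, ?_⟩
    · rw [Function.iterate_succ_apply', Function.iterate_succ_apply', h1, collatzT_add_two_mul,
        collatzOddCount]
      split_ifs <;> ring
    · rw [collatzOddCount, collatzOddCount, h1, h2, hmod]

theorem pow_collatzOddCount_succ_add (s : ℝ) (x : ℤ) (n : ℕ) :
    s ^ collatzOddCount x (n + 1) + s ^ collatzOddCount (x + 2 ^ n) (n + 1)
      = s ^ collatzOddCount x n * (1 + s) := by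
  obtain ⟨h1, h2⟩ := collatzT_iterate_add_two_pow_mul x n 1
  rw [mul_one] at h1 h2
  have hodd : (3 : ℤ) ^ collatzOddCount x n % 2 = 1 :=
    Int.odd_iff.1 (Odd.pow (by decide))
  rw [mul_one] at h1
  rw [collatzOddCount, collatzOddCount, h1, h2]
  generalize (3 : ℤ) ^ collatzOddCount x n = c at *
  generalize collatzT^[n] x = y at *
  by_cases hy : y % 2 = 1
  · have : ¬ (y + c) % 2 = 1 := by omega
    simp only [hy, this, if_true, if_false]; ring
  · have : (y + c) % 2 = 1 := by omega
    simp only [hy, this, if_true, if_false]; ring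

theorem sum_range_two_pow_pow_collatzOddCount (s : ℝ) (n : ℕ) (x : ℤ) :
    ∑ m ∈ Finset.range (2 ^ n), s ^ collatzOddCount (x + m) n = (1 + s) ^ n := by
  induction n with
  | zero => simp [collatzOddCount]
  | succ n ih =>
    rw [pow_succ 2 n, mul_two, Finset.sum_range_add, ← Finset.sum_add_distrib, pow_succ, ← ih,
      Finset.sum_mul]
    refine Finset.sum_congr rfl fun m _ => ?_
    rw [← pow_collatzOddCount_succ_add]
    push_cast
    congr 3
    ring

theorem sum_range_two_pow_mul_pow_collatzOddCount (s : ℝ) (n q : ℕ) :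
    ∑ m ∈ Finset.range (2 ^ n * q), s ^ collatzOddCount m n = q * (1 + s) ^ n := by
  induction q with
  | zero => simp
  | succ q ih =>
    rw [mul_add_one, Finset.sum_range_add, ih, ← sum_range_two_pow_pow_collatzOddCount s n
      ((2 ^ n * q : ℕ) : ℤ)]
    push_cast
    ring

/-- Markov's inequality for the weight `√3 ^ collatzOddCount`. -/
theorem card_filter_two_pow_le_mul_three_pow_le (n K N : ℕ) :
    (((Finset.Icc 1 N).filter (fun m : ℕ => 2 ^ n ≤ K ^ 2 * 3 ^ collatzOddCount m n)).card : ℝ)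
      ≤ K * ((1 + √3) / (2 * √2)) ^ n * (N + 2 ^ n) := by
  set B := (Finset.Icc 1 N).filter (fun m : ℕ => 2 ^ n ≤ K ^ 2 * 3 ^ collatzOddCount m n)
  have hB : B ⊆ Finset.range (2 ^ n * (N / 2 ^ n + 1)) := by
    intro m hm
    have h1 := (Finset.mem_Icc.1 (Finset.mem_filter.1 hm).1).2
    exact Finset.mem_range.2 (h1.trans_lt (Nat.lt_mul_div_succ N (by positivity)))
  have hq : ((N / 2 ^ n + 1 : ℕ) : ℝ) * 2 ^ n ≤ N + 2 ^ n := by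
    have := Nat.div_mul_le_self N (2 ^ n)
    have h : (((N / 2 ^ n) * 2 ^ n : ℕ) : ℝ) ≤ N := by exact_mod_cast this
    push_cast at h ⊢
    linarith
  have hmarkov : (B.card : ℝ) * √2 ^ n ≤ K * (((N / 2 ^ n + 1 : ℕ) : ℝ) * (1 + √3) ^ n) := by
    rw [← sum_range_two_pow_mul_pow_collatzOddCount, Finset.mul_sum, ← nsmul_eq_mul,
      ← Finset.sum_const]
    refine (Finset.sum_le_sum fun m hm => ?_).trans
      (Finset.sum_le_sum_of_subset_of_nonneg hB fun _ _ _ => by positivity)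
    have h1 : ((2 ^ n : ℕ) : ℝ) ≤ ((K ^ 2 * 3 ^ collatzOddCount m n : ℕ) : ℝ) :=
      Nat.cast_le.2 (Finset.mem_filter.1 hm).2
    push_cast at h1
    refine (sq_le_sq₀ (by positivity) (by positivity)).1 ?_
    rw [mul_pow, ← pow_mul, ← pow_mul, mul_comm n, mul_comm _ 2, pow_mul, pow_mul,
      Real.sq_sqrt (by norm_num), Real.sq_sqrt (by norm_num)]
    exact h1
  have h2 : (0 : ℝ) < √2 ^ n := by positivity
  calc (B.card : ℝ) ≤ K * (((N / 2 ^ n + 1 : ℕ) : ℝ) * (1 + √3) ^ n) / √2 ^ n :=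
        (le_div_iff₀ h2).2 hmarkov
    _ = K * ((1 + √3) / (2 * √2)) ^ n * (((N / 2 ^ n + 1 : ℕ) : ℝ) * 2 ^ n) := by
        rw [div_pow, mul_pow]
        field_simp
    _ ≤ _ := mul_le_mul_of_nonneg_left hq (by positivity)

theorem one_add_sqrt_three_div_lt_one : (1 + √3) / (2 * √2) < 1 := by
  rw [div_lt_one (by positivity)]
  have h2 : √2 ^ 2 = 2 := Real.sq_sqrt (by norm_num)
  have h3 : √3 ^ 2 = 3 := Real.sq_sqrt (by norm_num)
  refine lt_of_pow_lt_pow_left₀ 2 (by positivity) ?_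
  nlinarith [sq_nonneg (√3 - 2), Real.sqrt_nonneg 3]

theorem collatzT_iterate_mul_two_pow_lt {x : ℤ} {n k : ℕ} (hx : 2 ^ k * 3 ^ n ≤ x)
    (h : (2 ^ (k + 1)) ^ 2 * 3 ^ collatzOddCount x n < 2 ^ n) :
    collatzT^[n] x * 2 ^ k < x := by
  have h1 := two_pow_mul_collatzT_iterate_le x n
  have hx0 : 0 < x := lt_of_lt_of_le (by positivity) hx
  have h' : ((2 : ℤ) ^ (k + 1)) ^ 2 * 3 ^ collatzOddCount x n < 2 ^ n := by exact_mod_cast h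
  have hk : (1 : ℤ) ≤ 2 ^ k := one_le_pow₀ (by norm_num)
  have hA : (0 : ℤ) < 3 ^ collatzOddCount x n := by positivity
  have h4 : 2 * (2 ^ k * 3 ^ collatzOddCount x n) < (2 : ℤ) ^ n := by
    refine lt_of_le_of_lt ?_ h'
    rw [← mul_assoc, ← pow_succ']
    exact mul_le_mul_of_nonneg_right
      (le_self_pow₀ (one_le_pow₀ (by norm_num)) (by norm_num)) hA.le
  have hn : (2 : ℤ) ≤ 2 ^ n := by nlinarith
  have h5 := mul_le_mul_of_nonneg_left h1 (by positivity : (0 : ℤ) ≤ 2 ^ k)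
  have h6 := mul_lt_mul_of_pos_right h4 hx0
  have h7 := mul_le_mul_of_nonneg_right hn hx0.le
  refine lt_of_mul_lt_mul_left (a := (2 : ℤ) ^ n) ?_ (by positivity)
  nlinarith [mul_pos (by positivity : (0 : ℤ) < 2 ^ k) (by positivity : (0 : ℤ) < 2 ^ n)]

/-- A set of positive integers whose complement has arbitrarily small upper density has natural
density one. -/
theorem tendsto_card_filter_Icc_div_of_compl_le (P : ℕ → Prop) [DecidablePred P]
    (h : ∀ ε > 0, ∃ C : ℝ, ∀ N : ℕ,
      (((Finset.Icc 1 N).filter (fun m => ¬ P m)).card : ℝ) ≤ C + ε * N) :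
    Tendsto (fun N : ℕ => (((Finset.Icc 1 N).filter P).card : ℝ) / N) atTop (nhds 1) := by
  have hcard (N : ℕ) : (((Finset.Icc 1 N).filter P).card : ℝ)
      + ((Finset.Icc 1 N).filter (fun m => ¬ P m)).card = N := by
    have := Finset.card_filter_add_card_filter_not (s := Finset.Icc 1 N) P
    rw [Nat.card_Icc, Nat.add_sub_cancel] at this
    exact_mod_cast this
  refine tendsto_order.2 ⟨fun a ha => ?_, fun a ha => Eventually.of_forall fun N => ?_⟩
  · obtain ⟨C, hC⟩ := h ((1 - a) / 2) (by linarith)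
    have hlarge := (tendsto_natCast_atTop_atTop (R := ℝ)).eventually_gt_atTop (C / ((1 - a) / 2))
    filter_upwards [hlarge, eventually_gt_atTop 0] with N hN hpos
    have hN0 : (0 : ℝ) < N := Nat.cast_pos.2 hpos
    rw [lt_div_iff₀ hN0]
    rw [div_lt_iff₀ (by linarith)] at hN
    linarith [hC N, hcard N]
  · refine lt_of_le_of_lt (div_le_one_of_le₀ ?_ (by positivity)) ha
    linarith [hcard N, Nat.cast_nonneg (α := ℝ) ((Finset.Icc 1 N).filter (fun m => ¬ P m)).card]

/-- Coercing a `Finset ℕ` elementwise to a `Finset ℤ` preserves the number of elements satisfying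
a predicate. -/
theorem card_filter_bind_pure_natCast (s : Finset ℕ) (P : ℤ → Prop) :
    ((s >>= fun a => pure (a : ℤ)).filter P).card = (s.filter fun m : ℕ => P m).card := by
  have h : (s >>= fun a => pure (a : ℤ)) = s.map Nat.castEmbedding := by
    ext
    simp [Finset.bind_def, eq_comm]
  rw [h, Finset.filter_map, Finset.card_map]
  rfl

/-- Dolan, Gilman and Manickam (1987): for every `k ≥ 1`, the set of positive integers `m`
having at least `k` distinct iterates `T^(i)(m)` (with `i ≥ 1`) strictly less than `m`
has natural density one. -/
theorem dolan_gilman_manickam (k : ℕ) (hk : 1 ≤ k) :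
    Tendsto (fun N : ℕ =>
      (((Finset.Icc 1 N).filter
          (fun m => ∃ s : Finset ℤ, s.card = k ∧
            ∀ y ∈ s, y < (m : ℤ) ∧ ∃ i : ℕ, 1 ≤ i ∧ collatzT^[i] (m : ℤ) = y)).card : ℝ) / N)
      atTop (nhds 1) := by
  simp_rw [card_filter_bind_pure_natCast]
  refine tendsto_card_filter_Icc_div_of_compl_le _ fun ε hε => ?_
  have hlim : Tendsto (fun n : ℕ => ((2 ^ (k + 1) : ℕ) : ℝ) * ((1 + √3) / (2 * √2)) ^ n)
      atTop (nhds 0) := by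
    simpa using (tendsto_pow_atTop_nhds_zero_of_lt_one (by positivity)
      one_add_sqrt_three_div_lt_one).const_mul ((2 ^ (k + 1) : ℕ) : ℝ)
  obtain ⟨n, hn⟩ := (hlim.eventually_lt_const hε).exists
  refine ⟨((2 ^ k * 3 ^ n : ℕ) : ℝ) + ε * 2 ^ n, fun N => ?_⟩
  have hsub : (Finset.Icc 1 N).filter (fun m : ℕ => ¬ ∃ s : Finset ℤ, s.card = k ∧
      ∀ y ∈ s, y < (m : ℤ) ∧ ∃ i : ℕ, 1 ≤ i ∧ collatzT^[i] (m : ℤ) = y) ⊆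
      Finset.range (2 ^ k * 3 ^ n) ∪ (Finset.Icc 1 N).filter
        (fun m : ℕ => 2 ^ n ≤ (2 ^ (k + 1)) ^ 2 * 3 ^ collatzOddCount m n) := by
    intro m hm
    obtain ⟨hmN, hbad⟩ := Finset.mem_filter.1 hm
    rw [Finset.mem_union, Finset.mem_range, Finset.mem_filter]
    by_contra! hcon
    refine hbad (exists_finset_collatzT_iterate_lt (n := n) ?_ ?_)
    · exact_mod_cast (Finset.mem_Icc.1 hmN).1
    · exact collatzT_iterate_mul_two_pow_lt (by exact_mod_cast hcon.1) (hcon.2 hmN)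
  have hcard := (Finset.card_le_card hsub).trans (Finset.card_union_le _ _)
  rw [Finset.card_range] at hcard
  have hcardR := (Nat.cast_le (α := ℝ)).2 hcard
  rw [Nat.cast_add] at hcardR
  have hmarkov := card_filter_two_pow_le_mul_three_pow_le n (2 ^ (k + 1)) N
  have hmul := mul_le_mul_of_nonneg_right hn.le (by positivity : (0 : ℝ) ≤ N + 2 ^ n)
  linarith
end

section
/- If every positive integer n with n ≡ 1 (mod 4) has some iterate T^(k)(n) = 1, then every positive integer m has some iterate T^(k)(m) = 1. -/
theorem exists_iterate_collatzT_eq_one_of_step {x y : ℤ} (hxy : collatzT x = y)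
    (hy : ∃ k : ℕ, collatzT^[k] y = 1) : ∃ k : ℕ, collatzT^[k] x = 1 := by
  obtain ⟨k, hk⟩ := hy
  exact ⟨k + 1, by rw [Function.iterate_succ_apply, hxy, hk]⟩

theorem collatzT_two_mul (x : ℤ) : collatzT (2 * x) = x := by
  unfold collatzT
  split_ifs <;> omega

theorem collatzT_four_mul_sub_one (x : ℤ) : collatzT (4 * x - 1) = 2 * (3 * x) - 1 := by
  unfold collatzT
  split_ifs <;> omega

/-- Applying `T` to `2 ^ (j + 2) * c - 1` gives `2 ^ (j + 1) * (3 * c) - 1`, so the numbers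
`2 ^ (j + 1) * c - 1` with `c` odd descend to residue `1` modulo `4`. -/
theorem exists_iterate_collatzT_two_pow_mul_sub_one
    (H : ∀ n : ℕ, 0 < n → n % 4 = 1 → ∃ k : ℕ, collatzT^[k] (n : ℤ) = 1)
    (j c : ℕ) (hc : Odd c) : ∃ k : ℕ, collatzT^[k] (2 ^ (j + 1) * (c : ℤ) - 1) = 1 := by
  induction j generalizing c with
  | zero =>
    obtain ⟨d, rfl⟩ := hc
    convert H (4 * d + 1) (by omega) (by omega) using 4
    push_cast
    ring
  | succ j ih =>
    refine exists_iterate_collatzT_eq_one_of_step ?_ (ih (3 * c) (Odd.mul (by decide) hc))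
    convert collatzT_four_mul_sub_one (2 ^ j * (c : ℤ)) using 2 <;> push_cast <;> ring

/-- Cadogan (1984): to prove the 3x+1 Conjecture it suffices to check it for all
`n ≡ 1 (mod 4)`. -/
theorem cadogan_reduction
    (H : ∀ n : ℕ, 0 < n → n % 4 = 1 → ∃ k : ℕ, collatzT^[k] (n : ℤ) = 1) :
    ∀ m : ℕ, 0 < m → ∃ k : ℕ, collatzT^[k] (m : ℤ) = 1 := by
  intro m
  induction m using Nat.strong_induction_on with
  | _ m ih =>
    intro hm
    obtain ⟨d, rfl | hd⟩ := Nat.even_or_odd' m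
    · push_cast
      exact exists_iterate_collatzT_eq_one_of_step (collatzT_two_mul d)
        (ih d (by omega) (by omega))
    · obtain ⟨j, c, hc, hjc⟩ := Nat.exists_eq_two_pow_mul_odd (Nat.succ_ne_zero m)
      obtain _ | j := j
      · obtain ⟨e, rfl⟩ := hc
        omega
      · convert exists_iterate_collatzT_two_pow_mul_sub_one H j c hc using 4
        rw [eq_sub_iff_add_eq]
        exact_mod_cast hjc
end

section
/- The map Q_∞ : ℤ₂ → ℤ₂ is nowhere differentiable: for every α ∈ ℤ₂, the difference quotient (Q_∞(x) − Q_∞(α))/(x − α), viewed in the field ℚ₂ of 2-adic numbers, has no limit as x → α with x ≠ α. -/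
open Filter

open scoped Classical

/-- "Divide by 2" on the 2-adic integers, defined (via choice) on multiples of 2. -/
noncomputable def padicHalf (x : ℤ_[2]) : ℤ_[2] :=
  if h : ∃ c : ℤ_[2], x = 2 * c then h.choose else 0

/-- The 3x+1 function extended to the 2-adic integers:
`T(α) = (3α+1)/2` if `α ≡ 1 (mod 2)` and `T(α) = α/2` if `α ≡ 0 (mod 2)`. -/
noncomputable def padicT (α : ℤ_[2]) : ℤ_[2] :=
  if (2 : ℤ_[2]) ∣ α then padicHalf α else padicHalf (3 * α + 1)

/-- The map `Q_∞(α) = Σ_{i≥0} a_i 2^i` where `a_i ∈ {0,1}` and `a_i ≡ T^(i)(α) (mod 2)`. -/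
noncomputable def Qinf (α : ℤ_[2]) : ℤ_[2] :=
  ∑' i : ℕ, (if (2 : ℤ_[2]) ∣ padicT^[i] α then 0 else 1) * 2 ^ i

theorem padicHalf_two_mul (c : ℤ_[2]) : padicHalf (2 * c) = c := by
  have h : ∃ d : ℤ_[2], 2 * c = 2 * d := ⟨c, rfl⟩
  rw [padicHalf, dif_pos h]
  exact (mul_left_cancel₀ two_ne_zero h.choose_spec).symm

theorem norm_two_padicInt : ‖(2 : ℤ_[2])‖ = 2⁻¹ := by
  exact_mod_cast PadicInt.norm_p (p := 2)

theorem isUnit_iff_not_two_dvd (x : ℤ_[2]) : IsUnit x ↔ ¬ (2 : ℤ_[2]) ∣ x := by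
  rw [iff_not_comm, PadicInt.not_isUnit_iff, PadicInt.norm_lt_one_iff_dvd, Nat.cast_ofNat]

theorem not_two_dvd_one : ¬ (2 : ℤ_[2]) ∣ 1 :=
  (isUnit_iff_not_two_dvd 1).1 isUnit_one

theorem not_two_dvd_two_mul_add_one (c : ℤ_[2]) : ¬ (2 : ℤ_[2]) ∣ 2 * c + 1 := fun h =>
  not_two_dvd_one ((dvd_add_right (dvd_mul_right 2 c)).1 h)

theorem even_or_odd_padicInt (x : ℤ_[2]) : (∃ c, x = 2 * c) ∨ ∃ c, x = 2 * c + 1 := by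
  obtain ⟨n, hn, h⟩ := PadicInt.exists_mem_range (p := 2) x
  rw [PadicInt.maximalIdeal_eq_span_p, Ideal.mem_span_singleton] at h
  obtain ⟨c, hc⟩ := h
  push_cast at hc
  interval_cases n
  · exact .inl ⟨c, by simpa using hc⟩
  · exact .inr ⟨c, by rw [← hc]; simp⟩

theorem padicT_two_mul (c : ℤ_[2]) : padicT (2 * c) = c := by
  rw [padicT, if_pos (dvd_mul_right 2 c), padicHalf_two_mul]

theorem padicT_two_mul_add_one (c : ℤ_[2]) : padicT (2 * c + 1) = 3 * c + 2 := by
  rw [padicT, if_neg (not_two_dvd_two_mul_add_one c),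
    show 3 * (2 * c + 1) + 1 = 2 * (3 * c + 2) by ring, padicHalf_two_mul]

theorem summable_mul_two_pow (a : ℕ → ℤ_[2]) : Summable fun i => a i * 2 ^ i := by
  refine Summable.of_norm_bounded (g := fun i => (2⁻¹ : ℝ) ^ i)
    (summable_geometric_of_lt_one (by norm_num) (by norm_num)) fun i => ?_
  rw [norm_mul, norm_pow, norm_two_padicInt]
  exact mul_le_of_le_one_left (by positivity) (PadicInt.norm_le_one _)

theorem Qinf_eq_add_two_mul (x : ℤ_[2]) :
    Qinf x = (if (2 : ℤ_[2]) ∣ x then 0 else 1) + 2 * Qinf (padicT x) := by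
  rw [Qinf, (summable_mul_two_pow _).tsum_eq_zero_add, Qinf,
    ← (summable_mul_two_pow _).tsum_mul_left]
  congr 1
  · rw [pow_zero, mul_one, Function.iterate_zero_apply]
  · congr 1
    ext1 i
    rw [Function.iterate_succ_apply]
    ring

theorem Qinf_two_mul (c : ℤ_[2]) : Qinf (2 * c) = 2 * Qinf c := by
  rw [Qinf_eq_add_two_mul, if_pos (dvd_mul_right 2 c), padicT_two_mul, zero_add]

theorem Qinf_two_mul_add_one (c : ℤ_[2]) : Qinf (2 * c + 1) = 1 + 2 * Qinf (3 * c + 2) := by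
  rw [Qinf_eq_add_two_mul, if_neg (not_two_dvd_two_mul_add_one c), padicT_two_mul_add_one]

/-- `Q_∞` reproduces, up to a rescaling by a power of 3, its global shape on every ball. -/
theorem exists_Qinf_add_two_pow_mul_sub (n : ℕ) (α : ℤ_[2]) :
    ∃ (β : ℤ_[2]) (m : ℕ), ∀ u,
      Qinf (α + 2 ^ n * u) - Qinf α = 2 ^ n * (Qinf (β + 3 ^ m * u) - Qinf β) := by
  induction n generalizing α with
  | zero => exact ⟨α, 0, fun u => by simp⟩
  | succ n ih =>
    rcases even_or_odd_padicInt α with ⟨c, rfl⟩ | ⟨c, rfl⟩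
    · obtain ⟨β, m, h⟩ := ih c
      refine ⟨β, m, fun u => ?_⟩
      rw [show 2 * c + 2 ^ (n + 1) * u = 2 * (c + 2 ^ n * u) by ring, Qinf_two_mul, Qinf_two_mul]
      linear_combination 2 * h u
    · obtain ⟨β, m, h⟩ := ih (3 * c + 2)
      refine ⟨β, m + 1, fun u => ?_⟩
      rw [show 2 * c + 1 + 2 ^ (n + 1) * u = 2 * (c + 2 ^ n * u) + 1 by ring,
        Qinf_two_mul_add_one, Qinf_two_mul_add_one,
        show 3 * (c + 2 ^ n * u) + 2 = 3 * c + 2 + 2 ^ n * (3 * u) by ring,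
        show β + 3 ^ (m + 1) * u = β + 3 ^ m * (3 * u) by ring]
      linear_combination 2 * h (3 * u)

theorem Qinf_zero : Qinf 0 = 0 := by
  have h := Qinf_two_mul 0
  rw [mul_zero] at h
  linear_combination -h

theorem three_mul_Qinf_one : 3 * Qinf 1 = -1 := by
  have h := Qinf_two_mul_add_one 0
  have h2 := Qinf_two_mul 1
  norm_num at h h2
  linear_combination -h - 2 * h2

theorem Qinf_three : Qinf 3 = 3 + 32 * Qinf 1 := by
  have h3 := Qinf_two_mul_add_one 1
  have h5 := Qinf_two_mul_add_one 2
  have h8 := Qinf_two_mul 4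
  have h4 := Qinf_two_mul 2
  have h2 := Qinf_two_mul 1
  norm_num at h3 h5 h8 h4 h2
  linear_combination h3 + 2 * h5 + 4 * h8 + 8 * h4 + 16 * h2

theorem norm_Qinf_three_sub : ‖Qinf 3 - 3 * Qinf 1‖ = 1 / 4 := by
  have hu : ‖8 * Qinf 1 + 1‖ = 1 := by
    rw [← PadicInt.isUnit_iff, isUnit_iff_not_two_dvd,
      show 8 * Qinf 1 + 1 = 2 * (4 * Qinf 1) + 1 by ring]
    exact not_two_dvd_two_mul_add_one _
  rw [Qinf_three, three_mul_Qinf_one,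
    show (3 + 32 * Qinf 1 - -1 : ℤ_[2]) = 2 ^ 2 * (8 * Qinf 1 + 1) by ring, norm_mul, norm_pow,
    norm_two_padicInt, hu]
  norm_num

theorem isUnit_three_padicInt : IsUnit (3 : ℤ_[2]) := by
  rw [isUnit_iff_not_two_dvd, show (3 : ℤ_[2]) = 2 * 1 + 1 by norm_num]
  exact not_two_dvd_two_mul_add_one 1

/-- Müller (1991): `Q_∞` is nowhere differentiable; for every `α ∈ ℤ₂` the difference quotient
`(Q_∞(x) − Q_∞(α))/(x − α)`, viewed in `ℚ₂`, has no limit as `x → α`, `x ≠ α`. -/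
theorem Qinf_nowhere_differentiable (α : ℤ_[2]) :
    ¬ ∃ L : ℚ_[2],
      Tendsto (fun x : ℤ_[2] =>
          ((Qinf x : ℚ_[2]) - (Qinf α : ℚ_[2])) / ((x : ℚ_[2]) - (α : ℚ_[2])))
        (nhdsWithin α {α}ᶜ) (nhds L) := by
  rintro ⟨L, hL⟩
  rw [Metric.tendsto_nhdsWithin_nhds] at hL
  obtain ⟨δ, hδ, hL⟩ := hL (1 / 4) (by norm_num)
  obtain ⟨n, hn⟩ := exists_pow_lt_of_lt_one hδ (show (2⁻¹ : ℝ) < 1 by norm_num)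
  obtain ⟨β, m, hQ⟩ := exists_Qinf_add_two_pow_mul_sub n α
  obtain ⟨r, hr⟩ := (isUnit_three_padicInt.pow m).exists_right_inv
  have c2 : ((2 : ℤ_[2]) : ℚ_[2]) = 2 := map_ofNat PadicInt.Coe.ringHom 2
  have c3 : ((3 : ℤ_[2]) : ℚ_[2]) = 3 := map_ofNat PadicInt.Coe.ringHom 3
  have approx (y : ℤ_[2]) :
      ‖((Qinf y : ℚ_[2]) - Qinf β) - L * ((r * (y - β) : ℤ_[2]) : ℚ_[2])‖ < 1 / 4 := by
    set u := r * (y - β)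
    have hy : β + 3 ^ m * u = y := by linear_combination (y - β) * hr
    rcases eq_or_ne u 0 with h0 | h0
    · rw [h0, mul_zero, add_zero] at hy
      simp [h0, hy]
    have hu0 : (u : ℚ_[2]) ≠ 0 := PadicInt.coe_ne_zero.2 h0
    have hx : α + 2 ^ n * u ∈ ({α}ᶜ : Set ℤ_[2]) := by simp [h0]
    have hd : dist (α + 2 ^ n * u) α < δ := by
      rw [dist_eq_norm, add_sub_cancel_left, norm_mul, norm_pow, norm_two_padicInt]
      exact (mul_le_of_le_one_right (by positivity) (PadicInt.norm_le_one u)).trans_lt hn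
    have h := hL hx hd
    have hq : ((Qinf (α + 2 ^ n * u) : ℚ_[2]) - Qinf α) = 2 ^ n * ((Qinf y : ℚ_[2]) - Qinf β) := by
      rw [← hy]
      simpa [c2] using congrArg ((↑) : ℤ_[2] → ℚ_[2]) (hQ u)
    rw [hq, dist_eq_norm] at h
    push_cast at h
    rw [c2, add_sub_cancel_left, mul_div_mul_left _ _ (pow_ne_zero n two_ne_zero)] at h
    rw [show (Qinf y : ℚ_[2]) - Qinf β - L * u = (((Qinf y : ℚ_[2]) - Qinf β) / u - L) * u by
      field_simp, norm_mul]
    exact (mul_le_of_le_one_right (norm_nonneg _) (PadicInt.norm_le_one u)).trans_lt h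
  have e0 := approx 0
  have e1 := approx 1
  have e3 := approx 3
  have ultra {a b : ℚ_[2]} (ha : ‖a‖ < 1 / 4) (hb : ‖b‖ < 1 / 4) : ‖a + b‖ < 1 / 4 :=
    (Padic.nonarchimedean a b).trans_lt (max_lt ha hb)
  have scale (k : ℤ_[2]) {a : ℚ_[2]} (ha : ‖a‖ < 1 / 4) : ‖(k : ℚ_[2]) * a‖ < 1 / 4 := by
    rw [norm_mul]
    exact (mul_le_of_le_one_left (norm_nonneg _) (PadicInt.norm_le_one k)).trans_lt ha
  have key := ultra e3 (ultra (scale (-3) e1) (scale 2 e0))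
  refine key.ne ?_
  rw [← norm_Qinf_three_sub, PadicInt.norm_def, Qinf_zero]
  congr 1
  push_cast
  rw [c2, c3]
  ring
end
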